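/- arXiv:2206.06595 — 12 statements merged into one kernel-verified Lean document; each statement's English description precedes it below -/
import Mathlib

section
/- For all integers K and N, let A and B be the 4×4 integer matrices (rows listed top to bottom) A = [[1,0,N,N],[0,1,-2,-2(K-1)],[0,0,1,0],[0,0,0,1]] and B = [[1,0,0,0],[0,1,0,0],[K,K,1,0],[-2,-2(N-1),0,1]]. Then the characteristic polynomial of the product A·B equals X^4 + (6N + K(6-5N) - 8)·X^3 + 2·(7 - 6N + 2K²(N-2)N + K(-4N² + 13N - 6))·X^2 + (6N + K(6-5N) - 8)·X + 1. -/
open Polynomial Matrix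

/-- The characteristic polynomial of the product of the horizontal and vertical
Dehn multi-twist matrices of the origami `O'_{K,N}`. -/
theorem charpoly_AB (K N : ℤ)
    (A B : Matrix (Fin 4) (Fin 4) ℤ)
    (hA : A = !![1, 0, N, N;
                 0, 1, -2, -2*(K-1);
                 0, 0, 1, 0;
                 0, 0, 0, 1])
    (hB : B = !![1, 0, 0, 0;
                 0, 1, 0, 0;
                 K, K, 1, 0;
                 -2, -2*(N-1), 0, 1]) :
    (A * B).charpoly =
      X ^ 4 + C (6*N + K*(6 - 5*N) - 8) * X ^ 3
        + C (2 * (7 - 6*N + 2*K^2*(N-2)*N + K*(-4*N^2 + 13*N - 6))) * X ^ 2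
        + C (6*N + K*(6 - 5*N) - 8) * X + 1 := by
  subst hA hB
  simp only [Matrix.charpoly, Matrix.charmatrix, Matrix.det_succ_row_zero, Fin.sum_univ_succ]
  simp [Fin.succAbove]
  ring
end

section
/- For every integer n ≥ 1, let D_α, D_β, D_γ be the 3×3 matrices over ℚ (rows listed top to bottom) D_α = [[1,-4n,0],[0,1,0],[0,0,1]], D_β = [[1,0,0],[4n,1,0],[0,0,1]], D_γ = [[1,0,0],[n(5n-4)²,1,0],[(5n-4)/2,0,1]]. Then D_γ⁴ · D_β^{-(5n-4)²} = [[1,0,0],[0,1,0],[2(5n-4),0,1]]. In particular, since 5n - 4 ≠ 0, this is a non-identity matrix of the form [[1,0,0],[0,1,0],[y,x,1]]. -/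
open Matrix

theorem lower_unipotent_mul (a b c d : ℚ) :
    (!![1, 0, 0; a, 1, 0; b, 0, 1] : Matrix (Fin 3) (Fin 3) ℚ) * !![1, 0, 0; c, 1, 0; d, 0, 1]
      = !![1, 0, 0; a + c, 1, 0; b + d, 0, 1] := by
  ext i j
  fin_cases i <;> fin_cases j <;> simp [Matrix.mul_apply, Fin.sum_univ_three]

theorem lower_unipotent_zero :
    (!![1, 0, 0; 0, 1, 0; 0, 0, 1] : Matrix (Fin 3) (Fin 3) ℚ) = 1 := by
  ext i j
  fin_cases i <;> fin_cases j <;> simp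

theorem lower_unipotent_pow (a b : ℚ) (k : ℕ) :
    (!![1, 0, 0; a, 1, 0; b, 0, 1] : Matrix (Fin 3) (Fin 3) ℚ) ^ k
      = !![1, 0, 0; k * a, 1, 0; k * b, 0, 1] := by
  induction k with
  | zero => simp [lower_unipotent_zero]
  | succ k ih => rw [pow_succ, ih, lower_unipotent_mul]; push_cast; simp only [add_mul, one_mul]

theorem lower_unipotent_inv (a b : ℚ) :
    (!![1, 0, 0; a, 1, 0; b, 0, 1] : Matrix (Fin 3) (Fin 3) ℚ)⁻¹
      = !![1, 0, 0; -a, 1, 0; -b, 0, 1] := by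
  apply Matrix.inv_eq_right_inv
  rw [lower_unipotent_mul, add_neg_cancel, add_neg_cancel, lower_unipotent_zero]

theorem lower_unipotent_zpow (a b : ℚ) (k : ℤ) :
    (!![1, 0, 0; a, 1, 0; b, 0, 1] : Matrix (Fin 3) (Fin 3) ℚ) ^ k
      = !![1, 0, 0; k * a, 1, 0; k * b, 0, 1] := by
  obtain ⟨m, rfl | rfl⟩ := k.eq_nat_or_neg
  · rw [zpow_natCast, lower_unipotent_pow]
    simp
  · rw [Matrix.zpow_neg_natCast, lower_unipotent_pow, lower_unipotent_inv]
    simp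

/-- A nontrivial unipotent-radical element for the origami family `O'_{3n,5n}`. -/
theorem unipotent_word_O_3n_5n (n : ℤ) (hn : 1 ≤ n)
    (Dα Dβ Dγ : Matrix (Fin 3) (Fin 3) ℚ)
    (hα : Dα = !![1, -4*(n:ℚ), 0; 0, 1, 0; 0, 0, 1])
    (hβ : Dβ = !![1, 0, 0; 4*(n:ℚ), 1, 0; 0, 0, 1])
    (hγ : Dγ = !![1, 0, 0; (n:ℚ)*(5*(n:ℚ)-4)^2, 1, 0; (5*(n:ℚ)-4)/2, 0, 1]) :
    Dγ ^ (4:ℕ) * Dβ ^ (-((5*n-4)^2) : ℤ)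
      = !![1, 0, 0; 0, 1, 0; 2*(5*(n:ℚ)-4), 0, 1] ∧
    5*(n:ℚ) - 4 ≠ 0 ∧
    !![1, 0, 0; 0, 1, 0; 2*(5*(n:ℚ)-4), 0, 1] ≠ (1 : Matrix (Fin 3) (Fin 3) ℚ) := by
  have hne : 5 * (n : ℚ) - 4 ≠ 0 := by
    have : (1 : ℚ) ≤ n := by exact_mod_cast hn
    linarith
  refine ⟨?_, hne, fun h => ?_⟩
  · rw [hγ, hβ, lower_unipotent_pow, lower_unipotent_zpow, lower_unipotent_mul]
    push_cast
    congr! 4 <;> ring_nf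
  · have h20 := congrFun (congrFun h 2) 0
    simp at h20
    exact hne h20
end

section
/- For every integer k ≥ 1, let D₁, D₂, D₃ be the 3×3 matrices over ℚ (rows listed top to bottom) D₁ = [[1,-2,0],[0,1,0],[0,0,1]], D₂ = [[1-600k, -50, 0],[7200k², 1+600k, 0],[120k, 10, 1]], D₃ = [[1,0,0],[4,1,0],[0,0,1]]. Then D₃^{3k} · D₂ · D₃^{-3k} · D₁^{-25} = [[1,0,0],[0,1,0],[0,10,1]], a non-identity matrix of the form [[1,0,0],[0,1,0],[y,x,1]]. -/
open Matrix

theorem Matrix.transvection_pow {n R : Type*} [DecidableEq n] [Fintype n] [CommRing R]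
    {i j : n} (h : i ≠ j) (c : R) (m : ℕ) :
    transvection i j c ^ m = transvection i j (m * c) := by
  induction m with
  | zero => simp
  | succ m ih =>
    rw [pow_succ, ih, transvection_mul_transvection_same _ _ h]
    push_cast
    ring_nf

theorem Matrix.transvection_inv {n R : Type*} [DecidableEq n] [Fintype n] [CommRing R]
    {i j : n} (h : i ≠ j) (c : R) :
    (transvection i j c)⁻¹ = transvection i j (-c) := by
  apply inv_eq_right_inv
  rw [transvection_mul_transvection_same _ _ h, add_neg_cancel, transvection_zero]

theorem Matrix.transvection_zpow {n R : Type*} [DecidableEq n] [Fintype n] [CommRing R]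
    {i j : n} (h : i ≠ j) (c : R) (m : ℤ) :
    transvection i j c ^ m = transvection i j (m * c) := by
  obtain ⟨m, rfl | rfl⟩ := m.eq_nat_or_neg
  · simp [transvection_pow h]
  · rw [zpow_neg_natCast, transvection_pow h, transvection_inv h]
    simp

theorem Matrix.transvection_zero_one_fin_three {R : Type*} [CommRing R] (c : R) :
    transvection (0 : Fin 3) 1 c = !![1, c, 0; 0, 1, 0; 0, 0, 1] := by
  ext i j
  fin_cases i <;> fin_cases j <;> simp [transvection]

theorem Matrix.transvection_one_zero_fin_three {R : Type*} [CommRing R] (c : R) :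
    transvection (1 : Fin 3) 0 c = !![1, 0, 0; c, 1, 0; 0, 0, 1] := by
  ext i j
  fin_cases i <;> fin_cases j <;> simp [transvection]

/-- A nontrivial unipotent-radical element for the family `F_{3n+8}` with `n = 20k-2`. -/
theorem unipotent_word_F3n8 (k : ℤ) (hk : 1 ≤ k)
    (D₁ D₂ D₃ : Matrix (Fin 3) (Fin 3) ℚ)
    (h₁ : D₁ = !![1, -2, 0; 0, 1, 0; 0, 0, 1])
    (h₂ : D₂ = !![1 - 600*(k:ℚ), -50, 0;
                  7200*(k:ℚ)^2, 1 + 600*(k:ℚ), 0;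
                  120*(k:ℚ), 10, 1])
    (h₃ : D₃ = !![1, 0, 0; 4, 1, 0; 0, 0, 1]) :
    D₃ ^ (3*k : ℤ) * D₂ * D₃ ^ (-(3*k) : ℤ) * D₁ ^ (-25 : ℤ)
      = !![1, 0, 0; 0, 1, 0; 0, 10, 1] ∧
    !![1, 0, 0; 0, 1, 0; (0:ℚ), 10, 1] ≠ (1 : Matrix (Fin 3) (Fin 3) ℚ) := by
  constructor
  · rw [h₁, h₂, h₃, ← transvection_zero_one_fin_three, ← transvection_one_zero_fin_three,
      transvection_zpow (by decide), transvection_zpow (by decide),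
      transvection_zpow (by decide), transvection_zero_one_fin_three,
      transvection_one_zero_fin_three, transvection_one_zero_fin_three]
    ext i j
    fin_cases i <;> fin_cases j <;>
      simp [Matrix.mul_apply, Fin.sum_univ_three] <;> ring
  · intro h
    have h21 := congrFun (congrFun h 2) 1
    simp at h21
end

section
/- For every odd integer k ≥ 1, let D₁, D₂, D₃ be the 3×3 matrices over ℚ (rows listed top to bottom) D₁ = [[1,2,0],[0,1,0],[0,0,1]], D₂ = [[1-18(k+1), -18, 0],[18(k+1)², 1+18(k+1), 0],[-6(k+1), -6, 1]], D₃ = [[1,0,0],[-2,1,0],[0,0,1]]. Then the subgroup of GL(3,ℚ) generated by D₁, D₂, D₃ contains the non-identity matrix [[1,0,0],[0,1,0],[0,-6,1]], which is of the form [[1,0,0],[0,1,0],[y,x,1]]. -/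
open Matrix

/-- The upper unipotent one-parameter subgroup `x ↦ 1 + x E₁₂` of `GL (Fin 3) ℚ`. -/
def upperUnipotent : Multiplicative ℚ →* GL (Fin 3) ℚ :=
  MonoidHom.toHomUnits
    { toFun := fun x => !![1, x.toAdd, 0; 0, 1, 0; 0, 0, 1]
      map_one' := by ext i j; fin_cases i <;> fin_cases j <;> simp
      map_mul' := fun x y => by
        ext i j
        fin_cases i <;> fin_cases j <;> simp [Matrix.mul_apply, Fin.sum_univ_three, add_comm] }

/-- The lower unipotent one-parameter subgroup `x ↦ 1 + x E₂₁` of `GL (Fin 3) ℚ`. -/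
def lowerUnipotent : Multiplicative ℚ →* GL (Fin 3) ℚ :=
  MonoidHom.toHomUnits
    { toFun := fun x => !![1, 0, 0; x.toAdd, 1, 0; 0, 0, 1]
      map_one' := by ext i j; fin_cases i <;> fin_cases j <;> simp
      map_mul' := fun x y => by
        ext i j
        fin_cases i <;> fin_cases j <;> simp [Matrix.mul_apply, Fin.sum_univ_three] }

theorem coe_upperUnipotent (x : ℚ) :
    (upperUnipotent (.ofAdd x) : Matrix (Fin 3) (Fin 3) ℚ) = !![1, x, 0; 0, 1, 0; 0, 0, 1] :=
  rfl

theorem coe_lowerUnipotent (x : ℚ) :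
    (lowerUnipotent (.ofAdd x) : Matrix (Fin 3) (Fin 3) ℚ) = !![1, 0, 0; x, 1, 0; 0, 0, 1] :=
  rfl

/-- The element `1 - 6 E₃₂` of `GL (Fin 3) ℚ`. -/
def radicalElement : GL (Fin 3) ℚ where
  val := !![1, 0, 0; 0, 1, 0; 0, -6, 1]
  inv := !![1, 0, 0; 0, 1, 0; 0, 6, 1]
  val_inv := by
    ext i j; fin_cases i <;> fin_cases j <;> simp [Matrix.mul_apply, Fin.sum_univ_three]
  inv_val := by
    ext i j; fin_cases i <;> fin_cases j <;> simp [Matrix.mul_apply, Fin.sum_univ_three]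

theorem coe_conj_upperUnipotent_mul_radicalElement (m : ℚ) :
    ((lowerUnipotent (.ofAdd (-m)) * (upperUnipotent (.ofAdd (-18)) * radicalElement) *
      lowerUnipotent (.ofAdd m) : GL (Fin 3) ℚ) : Matrix (Fin 3) (Fin 3) ℚ) =
      !![1 - 18 * m, -18, 0; 18 * m ^ 2, 1 + 18 * m, 0; -6 * m, -6, 1] := by
  simp only [Units.val_mul, coe_lowerUnipotent, coe_upperUnipotent, radicalElement]
  ext i j
  fin_cases i <;> fin_cases j <;> simp [Matrix.mul_apply, Fin.sum_univ_three] <;> ring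

/-- The group generated by the three transvections of the family `F_{3n+10}`
(`n = 2k-1`) contains a nontrivial unipotent-radical element. -/
theorem unipotent_in_closure_F3n10 (k : ℤ) (hk : 1 ≤ k) (hodd : Odd k) :
    ∃ g₁ g₂ g₃ h : GL (Fin 3) ℚ,
      (g₁ : Matrix (Fin 3) (Fin 3) ℚ) = !![1, 2, 0; 0, 1, 0; 0, 0, 1] ∧
      (g₂ : Matrix (Fin 3) (Fin 3) ℚ)
        = !![1 - 18*((k:ℚ)+1), -18, 0;
             18*((k:ℚ)+1)^2, 1 + 18*((k:ℚ)+1), 0;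
             -6*((k:ℚ)+1), -6, 1] ∧
      (g₃ : Matrix (Fin 3) (Fin 3) ℚ) = !![1, 0, 0; -2, 1, 0; 0, 0, 1] ∧
      h ∈ Subgroup.closure {g₁, g₂, g₃} ∧
      (h : Matrix (Fin 3) (Fin 3) ℚ) = !![1, 0, 0; 0, 1, 0; 0, -6, 1] ∧
      !![1, 0, 0; 0, 1, 0; (0:ℚ), -6, 1] ≠ (1 : Matrix (Fin 3) (Fin 3) ℚ) := by
  obtain ⟨s, rfl⟩ := hodd
  set m : ℚ := ((2 * s + 1 : ℤ) : ℚ) + 1 with hm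
  have upper_pow : upperUnipotent (.ofAdd 2) ^ (9 : ℕ) = (upperUnipotent (.ofAdd (-18)))⁻¹ := by
    rw [← map_pow, ← map_inv, ← ofAdd_nsmul, ← ofAdd_neg]
    norm_num
  have lower_zpow : lowerUnipotent (.ofAdd (-2)) ^ (s + 1) = lowerUnipotent (.ofAdd (-m)) := by
    rw [← map_zpow, ← ofAdd_zsmul, hm]
    congr 2
    push_cast [zsmul_eq_mul]
    ring
  have lower_neg : lowerUnipotent (.ofAdd (-m)) = (lowerUnipotent (.ofAdd m))⁻¹ := by
    rw [← map_inv, ofAdd_neg]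
  refine ⟨upperUnipotent (.ofAdd 2),
    lowerUnipotent (.ofAdd (-m)) * (upperUnipotent (.ofAdd (-18)) * radicalElement) *
      lowerUnipotent (.ofAdd m),
    lowerUnipotent (.ofAdd (-2)), radicalElement, coe_upperUnipotent 2,
    coe_conj_upperUnipotent_mul_radicalElement m, coe_lowerUnipotent (-2), ?_, rfl, ?_⟩
  · set g₂ := lowerUnipotent (.ofAdd (-m)) * (upperUnipotent (.ofAdd (-18)) * radicalElement) *
      lowerUnipotent (.ofAdd m) with hg₂
    set G := Subgroup.closure
      {upperUnipotent (.ofAdd 2), g₂, lowerUnipotent (.ofAdd (-2))}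
    have h₁ : upperUnipotent (.ofAdd 2) ∈ G := Subgroup.subset_closure (by simp)
    have h₂ : g₂ ∈ G := Subgroup.subset_closure (by simp)
    have h₃ : lowerUnipotent (.ofAdd (-m)) ∈ G :=
      lower_zpow ▸ zpow_mem (Subgroup.subset_closure (by simp)) _
    have word : radicalElement = upperUnipotent (.ofAdd 2) ^ 9 *
        ((lowerUnipotent (.ofAdd (-m)))⁻¹ * g₂ * lowerUnipotent (.ofAdd (-m))) := by
      rw [upper_pow, hg₂, lower_neg]
      group
    rw [word]
    exact mul_mem (pow_mem h₁ 9) (mul_mem (mul_mem (inv_mem h₃) h₂) h₃)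
  · intro h
    simpa using congr_fun₂ h 2 1
end

section
/- For every integer k ≥ 1, let D₁, D₂, D₃ be the 3×3 matrices over ℚ (rows listed top to bottom) D₁ = [[1,6,0],[0,1,0],[0,0,1]], D₂ = [[1+324k, 1944k², 0],[-54, 1-324k, 0],[18, 108k, 1]], D₃ = [[1,0,0],[-6,1,0],[0,0,1]]. Then D₁^{k} · D₂ · D₁^{-k} · D₃^{-9} = [[1,0,0],[0,1,0],[18,0,1]], a non-identity matrix of the form [[1,0,0],[0,1,0],[y,x,1]]. -/
open Matrix

/-- A nontrivial unipotent-radical element for the family `F_{6n+18}` with `n = 3k-1`. -/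
theorem unipotent_word_F6n18 (k : ℤ) (hk : 1 ≤ k)
    (D₁ D₂ D₃ : Matrix (Fin 3) (Fin 3) ℚ)
    (h₁ : D₁ = !![1, 6, 0; 0, 1, 0; 0, 0, 1])
    (h₂ : D₂ = !![1 + 324*(k:ℚ), 1944*(k:ℚ)^2, 0;
                  -54, 1 - 324*(k:ℚ), 0;
                  18, 108*(k:ℚ), 1])
    (h₃ : D₃ = !![1, 0, 0; -6, 1, 0; 0, 0, 1]) :
    D₁ ^ (k : ℤ) * D₂ * D₁ ^ (-k : ℤ) * D₃ ^ (-9 : ℤ)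
      = !![1, 0, 0; 0, 1, 0; 18, 0, 1] ∧
    !![1, 0, 0; 0, 1, 0; (18:ℚ), 0, 1] ≠ (1 : Matrix (Fin 3) (Fin 3) ℚ) := by
  have e₁ (c : ℚ) : !![1, c, 0; 0, 1, 0; 0, 0, 1] = transvection (0 : Fin 3) 1 c := by
    ext i j
    fin_cases i <;> fin_cases j <;> simp [transvection, single]
  have e₃ (c : ℚ) : !![1, 0, 0; c, 1, 0; 0, 0, 1] = transvection (1 : Fin 3) 0 c := by
    ext i j
    fin_cases i <;> fin_cases j <;> simp [transvection, single]
  constructor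
  · rw [h₁, h₂, h₃, e₁, e₃, transvection_zpow (by decide), transvection_zpow (by decide),
      transvection_zpow (by decide), ← e₁, ← e₁, ← e₃]
    ext i j
    fin_cases i <;> fin_cases j <;> simp [mul_apply, Fin.sum_univ_three] <;> ring
  · intro h
    simpa using congrFun (congrFun h 2) 0
end

section
/- For every integer k ≥ 1, let D₁, D₂, D₃ be the 3×3 matrices over ℚ (rows listed top to bottom) D₁ = [[1,8,0],[0,1,0],[0,0,1]], D₂ = [[1+576k, 4608k², 0],[-72, 1-576k, 0],[-24, -192k, 1]], D₃ = [[1,0,0],[-8,1,0],[0,0,1]]. Then D₁^{k} · D₂ · D₁^{-k} · D₃^{-9} = [[1,0,0],[0,1,0],[-24,0,1]], a non-identity matrix of the form [[1,0,0],[0,1,0],[y,x,1]]. -/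
open Matrix

theorem upper_transvection_pow (a : ℚ) (n : ℕ) :
    (!![1, a, 0; 0, 1, 0; 0, 0, 1] : Matrix (Fin 3) (Fin 3) ℚ) ^ n =
      !![1, n * a, 0; 0, 1, 0; 0, 0, 1] := by
  induction n with
  | zero => ext i j; fin_cases i <;> fin_cases j <;> simp
  | succ n ih =>
    rw [pow_succ, ih]
    ext i j
    fin_cases i <;> fin_cases j <;> simp [Matrix.mul_apply, Fin.sum_univ_three]
    ring

theorem upper_transvection_inv (a : ℚ) :
    (!![1, a, 0; 0, 1, 0; 0, 0, 1] : Matrix (Fin 3) (Fin 3) ℚ)⁻¹ =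
      !![1, -a, 0; 0, 1, 0; 0, 0, 1] := by
  apply Matrix.inv_eq_right_inv
  ext i j
  fin_cases i <;> fin_cases j <;> simp [Matrix.mul_apply, Fin.sum_univ_three]

theorem upper_transvection_zpow (a : ℚ) (n : ℤ) :
    (!![1, a, 0; 0, 1, 0; 0, 0, 1] : Matrix (Fin 3) (Fin 3) ℚ) ^ n =
      !![1, n * a, 0; 0, 1, 0; 0, 0, 1] := by
  obtain ⟨m, rfl | rfl⟩ := n.eq_nat_or_neg
  · rw [zpow_natCast, upper_transvection_pow, Int.cast_natCast]
  · rw [Matrix.zpow_neg_natCast, upper_transvection_pow, upper_transvection_inv]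
    simp

theorem lower_transvection_zpow (a : ℚ) (n : ℤ) :
    (!![1, 0, 0; a, 1, 0; 0, 0, 1] : Matrix (Fin 3) (Fin 3) ℚ) ^ n =
      !![1, 0, 0; n * a, 1, 0; 0, 0, 1] := by
  have transpose_eq (b : ℚ) : (!![1, 0, 0; b, 1, 0; 0, 0, 1] : Matrix (Fin 3) (Fin 3) ℚ) =
      (!![1, b, 0; 0, 1, 0; 0, 0, 1] : Matrix (Fin 3) (Fin 3) ℚ).transpose := by
    ext i j; fin_cases i <;> fin_cases j <;> rfl
  rw [transpose_eq, transpose_eq, ← Matrix.transpose_zpow, upper_transvection_zpow]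

/-- A nontrivial unipotent-radical element for the family `F_{6n+22}` with `n = 4k-1`. -/
theorem unipotent_word_F6n22 (k : ℤ) (hk : 1 ≤ k)
    (D₁ D₂ D₃ : Matrix (Fin 3) (Fin 3) ℚ)
    (h₁ : D₁ = !![1, 8, 0; 0, 1, 0; 0, 0, 1])
    (h₂ : D₂ = !![1 + 576*(k:ℚ), 4608*(k:ℚ)^2, 0;
                  -72, 1 - 576*(k:ℚ), 0;
                  -24, -192*(k:ℚ), 1])
    (h₃ : D₃ = !![1, 0, 0; -8, 1, 0; 0, 0, 1]) :
    D₁ ^ (k : ℤ) * D₂ * D₁ ^ (-k : ℤ) * D₃ ^ (-9 : ℤ)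
      = !![1, 0, 0; 0, 1, 0; -24, 0, 1] ∧
    !![1, 0, 0; 0, 1, 0; (-24:ℚ), 0, 1] ≠ (1 : Matrix (Fin 3) (Fin 3) ℚ) := by
  subst h₁ h₂ h₃
  constructor
  · rw [upper_transvection_zpow, upper_transvection_zpow, lower_transvection_zpow]
    ext i j
    fin_cases i <;> fin_cases j <;> simp [Matrix.mul_apply, Fin.sum_univ_three] <;> ring
  · intro h
    have entry := congrFun (congrFun h 2) 0
    simp at entry
end

section
/- For every integer n, let A and B be the 4×4 integer matrices (rows listed top to bottom) A = [[1,0,n-1,0],[0,1,-2(n+1),-(n+1)],[0,0,1,0],[0,0,0,1]] and B = [[1,0,0,0],[0,1,0,0],[2-n,1-n,1,0],[1-n,2-n,0,1]]. Then the characteristic polynomial of A·B equals X⁴ + a·X³ + b·X² + a·X + 1, where a = -2(n² + n - 1) and b = 2n³ + n² + 2n - 3. -/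
open Polynomial Matrix

/-- The characteristic polynomial of the product of the Dehn multi-twist
matrices of the origami `P_{2n}` in directions `(1,1)` and `(-1,1)`. -/
theorem charpoly_AB_P2n (n : ℤ)
    (A B : Matrix (Fin 4) (Fin 4) ℤ)
    (hA : A = !![1, 0, n-1, 0;
                 0, 1, -2*(n+1), -(n+1);
                 0, 0, 1, 0;
                 0, 0, 0, 1])
    (hB : B = !![1, 0, 0, 0;
                 0, 1, 0, 0;
                 2-n, 1-n, 1, 0;
                 1-n, 2-n, 0, 1]) :
    (A * B).charpoly =
      X ^ 4 + C (-2*(n^2 + n - 1)) * X ^ 3 + C (2*n^3 + n^2 + 2*n - 3) * X ^ 2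
        + C (-2*(n^2 + n - 1)) * X + 1 := by
  subst hA hB
  simp [Matrix.charpoly, Matrix.charmatrix, Matrix.det_succ_row_zero, Fin.sum_univ_succ, Fin.succAbove]
  ring
end

section
/- For every integer N, let D_α, D_β, D_γ be the 3×3 matrices over ℚ (rows listed top to bottom) D_α = [[1,N-2,0],[0,1,0],[0,0,1]], D_β = [[1,0,0],[2-N,1,0],[0,0,1]], D_γ = [[1-2(N-2)², 4(N-2)³, 0],[2-N, 1+2(N-2)², 0],[N-2, -2(N-2)², 1]]. Then D_α^{-2} · D_γ · D_α^{2} · D_β^{-1} = [[1,0,0],[0,1,0],[N-2,0,1]]. In particular, when N ≠ 2 this is a non-identity matrix of the form [[1,0,0],[0,1,0],[y,x,1]]. -/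
open Matrix

/-- A nontrivial unipotent-radical element for the origami `P_N` in `H^{hyp}(4)`. -/
theorem unipotent_word_PN (N : ℤ)
    (Dα Dβ Dγ : Matrix (Fin 3) (Fin 3) ℚ)
    (hα : Dα = !![1, (N:ℚ)-2, 0; 0, 1, 0; 0, 0, 1])
    (hβ : Dβ = !![1, 0, 0; 2-(N:ℚ), 1, 0; 0, 0, 1])
    (hγ : Dγ = !![1 - 2*((N:ℚ)-2)^2, 4*((N:ℚ)-2)^3, 0;
                  2-(N:ℚ), 1 + 2*((N:ℚ)-2)^2, 0;
                  (N:ℚ)-2, -2*((N:ℚ)-2)^2, 1]) :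
    Dα ^ (-2 : ℤ) * Dγ * Dα ^ (2 : ℕ) * Dβ ^ (-1 : ℤ)
      = !![1, 0, 0; 0, 1, 0; (N:ℚ)-2, 0, 1] ∧
    (N ≠ 2 →
      !![1, 0, 0; 0, 1, 0; (N:ℚ)-2, 0, 1] ≠ (1 : Matrix (Fin 3) (Fin 3) ℚ)) := by
  have hα_inv : Dα⁻¹ = !![1, 2-(N:ℚ), 0; 0, 1, 0; 0, 0, 1] := by
    refine Matrix.inv_eq_right_inv ?_
    ext i j
    fin_cases i <;> fin_cases j <;> simp [hα, Matrix.mul_apply, Fin.sum_univ_three]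
  have hβ_inv : Dβ⁻¹ = !![1, 0, 0; (N:ℚ)-2, 1, 0; 0, 0, 1] := by
    refine Matrix.inv_eq_right_inv ?_
    ext i j
    fin_cases i <;> fin_cases j <;> simp [hβ, Matrix.mul_apply, Fin.sum_univ_three]
  have hα_zpow : Dα ^ (-2 : ℤ) = Dα⁻¹ * Dα⁻¹ := by
    rw [show (-2 : ℤ) = -((2 : ℕ) : ℤ) from rfl, Matrix.zpow_neg_natCast,
      ← Matrix.inv_pow', pow_two]
  refine ⟨?_, fun hN h => hN ?_⟩
  · rw [hα_zpow, Matrix.zpow_neg_one, hα_inv, hβ_inv, pow_two, hα, hγ]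
    ext i j
    fin_cases i <;> fin_cases j <;> simp [Matrix.mul_apply, Fin.sum_univ_three] <;> grind
  · have h20 : (N : ℚ) - 2 = 0 := by simpa using congrFun (congrFun h 2) 0
    exact_mod_cast sub_eq_zero.mp h20
end

section
/- For every natural number m, set A = -(20m + 10) and B = 3m + 6, and let D_χ and D_γ be the 3×3 matrices over ℚ (rows listed top to bottom) D_χ = [[1,0,0],[-A,1,0],[0,0,1]] and D_γ = [[1,0,0],[-2B²/A,1,0],[B/A,0,1]]. Then D_χ^{-2B²} · D_γ^{A²} = [[1,0,0],[0,1,0],[A·B,0,1]], and A·B ≠ 0, so this is a non-identity matrix of the form [[1,0,0],[0,1,0],[y,x,1]]. -/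
open Matrix

theorem firstColumnTransvection_mul {R : Type*} [CommRing R] (a b c d : R) :
    !![1, 0, 0; a, 1, 0; b, 0, 1] * !![1, 0, 0; c, 1, 0; d, 0, 1] =
      !![1, 0, 0; a + c, 1, 0; b + d, 0, 1] := by
  ext i j
  fin_cases i <;> fin_cases j <;> simp [Matrix.mul_apply, Fin.sum_univ_three]

theorem firstColumnTransvection_pow {R : Type*} [CommRing R] (a b : R) (n : ℕ) :
    !![1, 0, 0; a, 1, 0; b, 0, 1] ^ n = !![1, 0, 0; n * a, 1, 0; n * b, 0, 1] := by
  induction n with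
  | zero => simp [Matrix.one_fin_three]
  | succ n ih =>
    rw [pow_succ, ih, firstColumnTransvection_mul]
    simp [add_mul]

theorem firstColumnTransvection_zpow {R : Type*} [CommRing R] (a b : R) (n : ℤ) :
    !![1, 0, 0; a, 1, 0; b, 0, 1] ^ n = !![1, 0, 0; n * a, 1, 0; n * b, 0, 1] := by
  obtain ⟨k, rfl | rfl⟩ := n.eq_nat_or_neg
  · rw [zpow_natCast, firstColumnTransvection_pow, Int.cast_natCast]
  · rw [Matrix.zpow_neg_natCast, firstColumnTransvection_pow]
    apply Matrix.inv_eq_right_inv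
    rw [firstColumnTransvection_mul]
    simp [Matrix.one_fin_three]

/-- A nontrivial unipotent-radical element for the genus-four stairs origami
`O_{N,M}` with `N = 3m+4`, `M = 4+2m`. -/
theorem unipotent_word_stairs (m : ℕ) (A B : ℤ)
    (hA : A = -(20*(m:ℤ) + 10)) (hB : B = 3*(m:ℤ) + 6)
    (Dχ Dγ : Matrix (Fin 3) (Fin 3) ℚ)
    (hχ : Dχ = !![1, 0, 0; -(A:ℚ), 1, 0; 0, 0, 1])
    (hγ : Dγ = !![1, 0, 0; -2*(B:ℚ)^2/(A:ℚ), 1, 0; (B:ℚ)/(A:ℚ), 0, 1]) :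
    Dχ ^ (-(2*B^2) : ℤ) * Dγ ^ (A^2 : ℤ)
      = !![1, 0, 0; 0, 1, 0; (A:ℚ)*(B:ℚ), 0, 1] ∧
    (A:ℚ)*(B:ℚ) ≠ 0 ∧
    !![1, 0, 0; 0, 1, 0; (A:ℚ)*(B:ℚ), 0, 1] ≠ (1 : Matrix (Fin 3) (Fin 3) ℚ) := by
  have hA0 : (A : ℚ) ≠ 0 := by
    exact_mod_cast (by omega : A ≠ 0)
  have hB0 : (B : ℚ) ≠ 0 := by
    exact_mod_cast (by omega : B ≠ 0)
  have hAB : (A : ℚ) * B ≠ 0 := mul_ne_zero hA0 hB0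
  refine ⟨?_, hAB, fun h => hAB ?_⟩
  · rw [hχ, hγ, firstColumnTransvection_zpow, firstColumnTransvection_zpow,
      firstColumnTransvection_mul]
    push_cast
    congr! 5 <;> field_simp <;> ring
  · simpa using congrFun (congrFun h 2) 0
end

section
/- Let V be a vector space over ℚ, let Ω : V → V → ℚ be an alternating bilinear form, let γ₁, γ₂ ∈ V, and let c₁, c₂, f₁, f₂ ∈ ℚ with c₂ ≠ 0 and c₁f₁ + c₂f₂ ≠ 0. Suppose β ∈ V satisfies c₁·Ω(β, γ₁) = -c₂·Ω(β, γ₂). Then, setting X = f₂·γ₁ - f₁·γ₂ and c = c₁c₂/(c₁f₁ + c₂f₂), one has β + c₁f₂·Ω(β,γ₁)·γ₁ + c₂f₁·Ω(β,γ₂)·γ₂ = β + c·Ω(β, X)·X. -/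
/-- The affine multi-twist of a two-cylinder decomposition restricts to a
transvection on homology classes with proportional intersections. -/
theorem multitwist_restricts_to_transvection (V : Type*) [AddCommGroup V] [Module ℚ V]
    (Ω : V →ₗ[ℚ] V →ₗ[ℚ] ℚ) (hΩ : ∀ x : V, Ω x x = 0)
    (γ₁ γ₂ : V) (c₁ c₂ f₁ f₂ : ℚ) (hc₂ : c₂ ≠ 0)
    (hden : c₁*f₁ + c₂*f₂ ≠ 0)
    (β : V) (hβ : c₁ * Ω β γ₁ = -(c₂ * Ω β γ₂))
    (X : V) (hX : X = f₂ • γ₁ - f₁ • γ₂)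
    (c : ℚ) (hc : c = c₁*c₂ / (c₁*f₁ + c₂*f₂)) :
    β + (c₁*f₂ * Ω β γ₁) • γ₁ + (c₂*f₁ * Ω β γ₂) • γ₂ = β + (c * Ω β X) • X := by
  have hcX : c * Ω β X = c₁ * Ω β γ₁ := by
    have hΩX : Ω β X = f₂ * Ω β γ₁ - f₁ * Ω β γ₂ := by
      simp [hX]
    rw [hc, hΩX, div_mul_eq_mul_div, div_eq_iff hden]
    linear_combination (-(c₁ * f₁)) * hβ
  have h₁ : c₁ * f₂ * Ω β γ₁ = c₁ * Ω β γ₁ * f₂ := by ring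
  have h₂ : c₂ * f₁ * Ω β γ₂ = -(c₁ * Ω β γ₁ * f₁) := by
    linear_combination f₁ * hβ
  rw [hcX, h₁, h₂, hX, smul_sub, smul_smul, smul_smul, neg_smul, add_assoc, ← sub_eq_add_neg]
end

section
/- In SL(2,ℤ), the subgroup generated by the two matrices [[1,3],[0,1]] and [[1,0],[1,1]] equals the congruence subgroup {A ∈ SL(2,ℤ) : A₀₁ ≡ 0 (mod 3), A₀₀ ≡ 1 (mod 3) and A₁₁ ≡ 1 (mod 3)} (the transpose of Γ₁(3)); in particular this subgroup has finite index in SL(2,ℤ). -/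
open Matrix

theorem Int.exists_two_mul_abs_add_mul_le (a m : ℤ) (hm : m ≠ 0) :
    ∃ k : ℤ, 2 * |a + m * k| ≤ |m| := by
  refine ⟨-(round ((a : ℚ) / m)), ?_⟩
  have hm' : (m : ℚ) ≠ 0 := by exact_mod_cast hm
  have h := abs_sub_round ((a : ℚ) / m)
  have e : (a : ℚ) + m * (-(round ((a : ℚ) / m)) : ℤ) = m * ((a : ℚ) / m - round ((a : ℚ) / m)) := by
    push_cast
    field_simp
    ring
  have : 2 * |(a : ℚ) + m * (-(round ((a : ℚ) / m)) : ℤ)| ≤ |(m : ℚ)| := by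
    rw [e, abs_mul]
    nlinarith [abs_nonneg (m : ℚ)]
  exact_mod_cast this

namespace Matrix.SpecialLinearGroup

/-- The matrix `[[1, x], [0, 1]]`. -/
def upperUnipotent (x : ℤ) : SpecialLinearGroup (Fin 2) ℤ :=
  ⟨!![1, x; 0, 1], by simp [det_fin_two]⟩

/-- The matrix `[[1, 0], [x, 1]]`. -/
def lowerUnipotent (x : ℤ) : SpecialLinearGroup (Fin 2) ℤ :=
  ⟨!![1, 0; x, 1], by simp [det_fin_two]⟩

theorem coe_upperUnipotent (x : ℤ) : (upperUnipotent x).1 = !![1, x; 0, 1] := rfl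

theorem coe_lowerUnipotent (x : ℤ) : (lowerUnipotent x).1 = !![1, 0; x, 1] := rfl

theorem upperUnipotent_add (x y : ℤ) :
    upperUnipotent (x + y) = upperUnipotent x * upperUnipotent y := by
  ext i j
  fin_cases i <;> fin_cases j <;> simp [coe_upperUnipotent, add_comm]

theorem lowerUnipotent_add (x y : ℤ) :
    lowerUnipotent (x + y) = lowerUnipotent x * lowerUnipotent y := by
  ext i j
  fin_cases i <;> fin_cases j <;> simp [coe_lowerUnipotent]

theorem upperUnipotent_mul_mem {H : Subgroup (SpecialLinearGroup (Fin 2) ℤ)} {x : ℤ}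
    (h : upperUnipotent x ∈ H) (k : ℤ) : upperUnipotent (x * k) ∈ H := by
  let f : Multiplicative ℤ →* SpecialLinearGroup (Fin 2) ℤ :=
    MonoidHom.mk' (fun z ↦ upperUnipotent z.toAdd) fun a b ↦ upperUnipotent_add _ _
  have := H.zpow_mem h k
  rwa [show upperUnipotent x = f (.ofAdd x) from rfl, ← map_zpow, ← ofAdd_zsmul, smul_eq_mul,
    mul_comm] at this

theorem lowerUnipotent_mul_mem {H : Subgroup (SpecialLinearGroup (Fin 2) ℤ)} {x : ℤ}
    (h : lowerUnipotent x ∈ H) (k : ℤ) : lowerUnipotent (x * k) ∈ H := by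
  let f : Multiplicative ℤ →* SpecialLinearGroup (Fin 2) ℤ :=
    MonoidHom.mk' (fun z ↦ lowerUnipotent z.toAdd) fun a b ↦ lowerUnipotent_add _ _
  have := H.zpow_mem h k
  rwa [show lowerUnipotent x = f (.ofAdd x) from rfl, ← map_zpow, ← ofAdd_zsmul, smul_eq_mul,
    mul_comm] at this

/-- The transpose of `Γ₁(3)`. -/
def gammaOneThreeTranspose : Subgroup (SpecialLinearGroup (Fin 2) ℤ) where
  carrier := {A | A 0 1 ≡ 0 [ZMOD 3] ∧ A 0 0 ≡ 1 [ZMOD 3] ∧ A 1 1 ≡ 1 [ZMOD 3]}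
  one_mem' := by simp [Int.ModEq.refl]
  mul_mem' := by
    rintro A B ⟨hA₁, hA₂, hA₃⟩ ⟨hB₁, hB₂, hB₃⟩
    simp only [Set.mem_ofPred_eq, coe_mul, mul_apply, Fin.sum_univ_two]
    refine ⟨?_, ?_, ?_⟩
    · simpa using (hA₂.mul hB₁).add (hA₁.mul hB₃)
    · simpa using (hA₂.mul hB₂).add (hA₁.mul_right (B 1 0))
    · simpa using (hB₁.mul_left (A 1 0)).add (hA₃.mul hB₃)
  inv_mem' := by
    rintro A ⟨h₁, h₂, h₃⟩
    simp only [SL2_inv_expl]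
    exact ⟨by simpa using h₁.neg, by simpa using h₃, by simpa using h₂⟩

theorem mem_gammaOneThreeTranspose {A : SpecialLinearGroup (Fin 2) ℤ} :
    A ∈ gammaOneThreeTranspose ↔
      A 0 1 ≡ 0 [ZMOD 3] ∧ A 0 0 ≡ 1 [ZMOD 3] ∧ A 1 1 ≡ 1 [ZMOD 3] :=
  Iff.rfl

theorem upperUnipotent_three_mem : upperUnipotent 3 ∈ gammaOneThreeTranspose := by
  simp [mem_gammaOneThreeTranspose, coe_upperUnipotent, Int.ModEq]

theorem lowerUnipotent_one_mem : lowerUnipotent 1 ∈ gammaOneThreeTranspose := by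
  simp [mem_gammaOneThreeTranspose, coe_lowerUnipotent, Int.ModEq]

theorem eq_lowerUnipotent_of_mem {A : SpecialLinearGroup (Fin 2) ℤ}
    (hA : A ∈ gammaOneThreeTranspose) (h : A 0 1 = 0) : A = lowerUnipotent (A 1 0) := by
  obtain ⟨-, h₀, h₁⟩ := mem_gammaOneThreeTranspose.1 hA
  have hdet := A.det_coe
  rw [det_fin_two, h, zero_mul, sub_zero] at hdet
  have h01 : A 0 0 = 1 ∧ A 1 1 = 1 := by
    rcases Int.mul_eq_one_iff_eq_one_or_neg_one.1 hdet with h' | ⟨h', -⟩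
    · exact h'
    · rw [h'] at h₀
      exact absurd h₀ (by decide)
  ext i j
  fin_cases i <;> fin_cases j <;> simp [coe_lowerUnipotent, h, h01]

/-- A Euclidean step: right multiplication by a lower and then an upper unipotent matrix
shrinks the upper right entry. -/
theorem exists_natAbs_mul_lt {A : SpecialLinearGroup (Fin 2) ℤ}
    (hA : A ∈ gammaOneThreeTranspose) (h : A 0 1 ≠ 0) :
    ∃ k l : ℤ, ((A * lowerUnipotent (1 * k) * upperUnipotent (3 * l)) 0 1).natAbs <
      (A 0 1).natAbs := by
  obtain ⟨h₁, h₀, -⟩ := mem_gammaOneThreeTranspose.1 hA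
  obtain ⟨b, hb⟩ := Int.modEq_zero_iff_dvd.1 h₁
  obtain ⟨k, hk⟩ := Int.exists_two_mul_abs_add_mul_le (A 0 0) (A 0 1) h
  have ha : A 0 0 + A 0 1 * k ≠ 0 := by
    intro h'
    have := h₀.add (h₁.mul_right k)
    rw [h', zero_mul] at this
    exact absurd this (by decide)
  obtain ⟨l, hl⟩ := Int.exists_two_mul_abs_add_mul_le b _ ha
  refine ⟨k, l, ?_⟩
  have e : (A * lowerUnipotent (1 * k) * upperUnipotent (3 * l)) 0 1 =
      3 * (b + (A 0 0 + A 0 1 * k) * l) := by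
    simp [coe_lowerUnipotent, coe_upperUnipotent, mul_apply, Fin.sum_univ_two]
    linear_combination hb
  rw [e]
  zify
  rw [abs_mul]
  have := abs_pos.2 h
  norm_num
  linarith

theorem gammaOneThreeTranspose_le {H : Subgroup (SpecialLinearGroup (Fin 2) ℤ)}
    (hu : upperUnipotent 3 ∈ H) (hl : lowerUnipotent 1 ∈ H) : gammaOneThreeTranspose ≤ H := by
  intro A hA
  induction hn : (A 0 1).natAbs using Nat.strong_induction_on generalizing A with
  | _ n ih =>
    subst hn
    by_cases h : A 0 1 = 0
    · rw [eq_lowerUnipotent_of_mem hA h, ← one_mul (A 1 0)]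
      exact lowerUnipotent_mul_mem hl _
    · obtain ⟨k, l, hkl⟩ := exists_natAbs_mul_lt hA h
      have := ih _ hkl (mul_mem (mul_mem hA (lowerUnipotent_mul_mem lowerUnipotent_one_mem k))
        (upperUnipotent_mul_mem upperUnipotent_three_mem l)) rfl
      rwa [H.mul_mem_cancel_right (upperUnipotent_mul_mem hu l),
        H.mul_mem_cancel_right (lowerUnipotent_mul_mem hl k)] at this

theorem closure_unipotent_eq_gammaOneThreeTranspose :
    Subgroup.closure {upperUnipotent 3, lowerUnipotent 1} = gammaOneThreeTranspose := by
  apply le_antisymm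
  · rw [Subgroup.closure_le, Set.pair_subset_iff]
    exact ⟨upperUnipotent_three_mem, lowerUnipotent_one_mem⟩
  · exact gammaOneThreeTranspose_le (Subgroup.subset_closure (by simp))
      (Subgroup.subset_closure (by simp))

theorem finiteIndex_gammaOneThreeTranspose : gammaOneThreeTranspose.FiniteIndex := by
  have hle : CongruenceSubgroup.Gamma 3 ≤ gammaOneThreeTranspose := by
    intro A hA
    obtain ⟨h₀, h₁, -, h₃⟩ := CongruenceSubgroup.Gamma_mem.1 hA
    refine ⟨?_, ?_, ?_⟩
    all_goals
      refine (ZMod.intCast_eq_intCast_iff _ _ 3).1 ?_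
      simpa
  exact Subgroup.finiteIndex_of_le hle

end Matrix.SpecialLinearGroup

/-- In `SL(2,ℤ)`, the subgroup generated by `[[1,3],[0,1]]` and `[[1,0],[1,1]]`
is the transposed congruence subgroup `Γ₁(3)`, which has finite index. -/
theorem closure_eq_Gamma1_3 :
    (∀ A : Matrix.SpecialLinearGroup (Fin 2) ℤ,
      A ∈ Subgroup.closure
          ({⟨!![1, 3; 0, 1], by decide⟩, ⟨!![1, 0; 1, 1], by decide⟩} :
            Set (Matrix.SpecialLinearGroup (Fin 2) ℤ)) ↔
        ((A : Matrix (Fin 2) (Fin 2) ℤ) 0 1 ≡ 0 [ZMOD 3] ∧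
         (A : Matrix (Fin 2) (Fin 2) ℤ) 0 0 ≡ 1 [ZMOD 3] ∧
         (A : Matrix (Fin 2) (Fin 2) ℤ) 1 1 ≡ 1 [ZMOD 3])) ∧
    (Subgroup.closure
        ({⟨!![1, 3; 0, 1], by decide⟩, ⟨!![1, 0; 1, 1], by decide⟩} :
          Set (Matrix.SpecialLinearGroup (Fin 2) ℤ))).FiniteIndex := by
  have h := Matrix.SpecialLinearGroup.closure_unipotent_eq_gammaOneThreeTranspose
  simp only [Matrix.SpecialLinearGroup.upperUnipotent,
    Matrix.SpecialLinearGroup.lowerUnipotent] at h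
  rw [h]
  exact ⟨fun A ↦ Matrix.SpecialLinearGroup.mem_gammaOneThreeTranspose,
    Matrix.SpecialLinearGroup.finiteIndex_gammaOneThreeTranspose⟩
end

section
/- Let C₁ and C₂ be the 6×6 matrices over ℚ (rows listed top to bottom) C₁ = [[1,0,0,0,2,0],[0,1,0,0,0,1],[0,0,1,0,-1,0],[0,0,0,1,0,0],[0,0,0,0,1,0],[0,0,0,0,0,1]] and C₂ = [[0,0,0,0,-1,-1],[0,0,0,0,1,0],[0,1,1,1,0,-1],[0,0,-1,-1,0,1],[1,1,1,1,-1,-1],[-1,0,0,-1,1,0]]. Then the ℚ-subalgebra of the 6×6 matrix algebra generated by C₁ and C₂ has dimension 18 as a ℚ-vector space; in particular it is a proper subalgebra of the full 36-dimensional matrix algebra M₆(ℚ). -/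
open Matrix

namespace Origami

/-- The unipotent generator. -/
def unip : Matrix (Fin 6) (Fin 6) ℚ :=
  !![1, 0, 0, 0, 2, 0;
     0, 1, 0, 0, 0, 1;
     0, 0, 1, 0, -1, 0;
     0, 0, 0, 1, 0, 0;
     0, 0, 0, 0, 1, 0;
     0, 0, 0, 0, 0, 1]

/-- The second generator. -/
def gen : Matrix (Fin 6) (Fin 6) ℚ :=
  !![0, 0, 0, 0, -1, -1;
     0, 0, 0, 0, 1, 0;
     0, 1, 1, 1, 0, -1;
     0, 0, -1, -1, 0, 1;
     1, 1, 1, 1, -1, -1;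
     -1, 0, 0, -1, 1, 0]

/-- An element `J` of the commutant of the two generators, with `J ^ 2 + J + 2 = 0`. -/
def commutant : Matrix (Fin 6) (Fin 6) ℚ :=
  !![-1, -2, 0, 0, 0, 0;
     1, 0, 0, 0, 0, 0;
     1, 1, 1, 2, 0, -1;
     -1, 0, -2, -2, 1, 1;
     0, 0, 0, 0, -1, -1;
     0, 0, 0, 0, 2, 0]

/-- The products `gen ^ a * (unip - 1) * gen ^ b`, which form a basis of the algebra generated by
`unip` and `gen`. -/
def word (p : Fin 3 × Fin 6) : Matrix (Fin 6) (Fin 6) ℚ :=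
  gen ^ (p.1 : ℕ) * (unip - 1) * gen ^ (p.2 : ℕ)

lemma commute_commutant {M : Matrix (Fin 6) (Fin 6) ℚ}
    (hM : M ∈ Algebra.adjoin ℚ {unip, gen}) : Commute commutant M := by
  have h : Algebra.adjoin ℚ {unip, gen} ≤ Subalgebra.centralizer ℚ {commutant} := by
    refine Algebra.adjoin_le ?_
    rintro _ (rfl | rfl) <;> rw [SetLike.mem_coe, Subalgebra.mem_centralizer_iff] <;>
      rintro _ rfl <;> decide +kernel
  exact Subalgebra.mem_centralizer_iff ℚ |>.1 (h hM) _ rfl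

/-- The columns of index `0`, `2`, `4` of a matrix. -/
def evenColumns : Matrix (Fin 6) (Fin 6) ℚ →ₗ[ℚ] Matrix (Fin 6) (Fin 3) ℚ where
  toFun M := M.submatrix id ![0, 2, 4]
  map_add' _ _ := rfl
  map_smul' _ _ := rfl

lemma eq_zero_of_commute {M : Matrix (Fin 6) (Fin 6) ℚ} (hM : Commute commutant M)
    (h : evenColumns M = 0) : M = 0 := by
  have h0 (i) : M i 0 = 0 := congr_fun₂ h i 0
  have h2 (i) : M i 2 = 0 := congr_fun₂ h i 1
  have h4 (i) : M i 4 = 0 := congr_fun₂ h i 2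
  have hc (i j) := congr_fun₂ hM.eq i j
  simp only [mul_apply, Fin.sum_univ_six, h0, h2, h4] at hc
  have h3 (i) : M i 3 = 0 := by
    have := hc i 2
    simp [commutant, h2] at this
    exact this
  have h5 (i) : M i 5 = 0 := by
    have := hc i 4
    simp [commutant, h3, h4] at this
    exact this
  have h1 (i) : M i 1 = 0 := by
    have := hc i 0
    simp [commutant, h0, h3, h5] at this
    exact this.symm
  ext i j
  fin_cases j
  exacts [h0 i, h1 i, h2 i, h3 i, h4 i, h5 i]

/-- Rows dual to the vectors `gen ^ a *ᵥ ![2, 0, -1, 0, 0, 0]` and killing the vectors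
`gen ^ a *ᵥ ![0, 1, 0, 0, 0, 0]`, for `a < 3`. -/
def leftDual : Matrix (Fin 3) (Fin 6) ℚ :=
  !![1/7, 0, -5/7, -2/7, 5/7, 4/7;
     -2/7, 0, -4/7, -3/7, 4/7, -1/7;
     1/7, 0, 2/7, -2/7, -2/7, -3/7]

/-- Columns dual to the rows of index `4` of the matrices `gen ^ b`, for `b < 6`. -/
def rightDual : Matrix (Fin 6) (Fin 6) ℚ :=
  !![1, 1, 0, 1, 0, 0;
     -1, -1, -1, -1, -1, -1;
     0, 0, -1, 0, 0, 0;
     0, 0, 1, 0, 0, 1;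
     1, 0, 0, 0, 0, 0;
     -1, -1, -1, 0, -1, 0]

lemma leftDual_mul_word_mul_rightDual (p : Fin 3 × Fin 6) :
    leftDual * word p * rightDual = single p.1 p.2 1 := by
  revert p
  decide +kernel

lemma linearIndependent_word : LinearIndependent ℚ word := by
  refine LinearIndependent.of_comp
    (mulRightLinearMap (Fin 3) ℚ rightDual ∘ₗ mulLeftLinearMap (Fin 6) ℚ leftDual) ?_
  convert (stdBasis ℚ (Fin 3) (Fin 6)).linearIndependent using 1
  ext1 p
  rw [stdBasis_eq_single]
  exact leftDual_mul_word_mul_rightDual p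

end Origami

/-- The `ℚ`-algebra generated by the two Kontsevich--Zorich monodromy matrices of
the degree-7 genus-4 origami has dimension 18, hence is a proper subalgebra of
`M₆(ℚ)`. -/
theorem adjoin_dim_eighteen (C₁ C₂ : Matrix (Fin 6) (Fin 6) ℚ)
    (h₁ : C₁ = !![1, 0, 0, 0, 2, 0;
                  0, 1, 0, 0, 0, 1;
                  0, 0, 1, 0, -1, 0;
                  0, 0, 0, 1, 0, 0;
                  0, 0, 0, 0, 1, 0;
                  0, 0, 0, 0, 0, 1])
    (h₂ : C₂ = !![0, 0, 0, 0, -1, -1;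
                  0, 0, 0, 0, 1, 0;
                  0, 1, 1, 1, 0, -1;
                  0, 0, -1, -1, 0, 1;
                  1, 1, 1, 1, -1, -1;
                  -1, 0, 0, -1, 1, 0]) :
    Module.finrank ℚ (Algebra.adjoin ℚ ({C₁, C₂} : Set (Matrix (Fin 6) (Fin 6) ℚ))) = 18 ∧
    Algebra.adjoin ℚ ({C₁, C₂} : Set (Matrix (Fin 6) (Fin 6) ℚ)) ≠ ⊤ := by
  subst h₁ h₂
  change Module.finrank ℚ (Algebra.adjoin ℚ {Origami.unip, Origami.gen}) = 18 ∧
    Algebra.adjoin ℚ {Origami.unip, Origami.gen} ≠ ⊤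
  have hdim : Module.finrank ℚ (Algebra.adjoin ℚ {Origami.unip, Origami.gen}) = 18 := by
    apply le_antisymm
    · let f := Origami.evenColumns ∘ₗ
        (Algebra.adjoin ℚ {Origami.unip, Origami.gen}).val.toLinearMap
      have hf : Function.Injective f := by
        rw [← LinearMap.ker_eq_bot, LinearMap.ker_eq_bot']
        exact fun M hM ↦ Subtype.ext
          (Origami.eq_zero_of_commute (Origami.commute_commutant M.2) hM)
      simpa [Module.finrank_matrix] using LinearMap.finrank_le_finrank_of_injective hf
    · have hu : Origami.unip ∈ Algebra.adjoin ℚ {Origami.unip, Origami.gen} :=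
        Algebra.subset_adjoin (by simp)
      have hg : Origami.gen ∈ Algebra.adjoin ℚ {Origami.unip, Origami.gen} :=
        Algebra.subset_adjoin (by simp)
      let w (p : Fin 3 × Fin 6) : Algebra.adjoin ℚ {Origami.unip, Origami.gen} :=
        ⟨Origami.word p, mul_mem (mul_mem (pow_mem hg _) (sub_mem hu (one_mem _)))
          (pow_mem hg _)⟩
      have hw : LinearIndependent ℚ w :=
        LinearIndependent.of_comp
          (Algebra.adjoin ℚ {Origami.unip, Origami.gen}).val.toLinearMap
          Origami.linearIndependent_word
      simpa using hw.fintype_card_le_finrank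
  refine ⟨hdim, fun htop ↦ ?_⟩
  rw [htop, subalgebra_top_finrank_eq_submodule_top_finrank, finrank_top] at hdim
  simp [Module.finrank_matrix] at hdim
end
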